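/- The minimum, over all gradient vector fields (acyclic matchings) V on the matching complex M_7 of the complete graph K_7, of the total number of critical simplices of V is exactly 23 (attained with 21 critical 2-simplices, 1 critical 1-simplex, and 1 critical 0-simplex). -/

import Mathlib

/-- A simplex of the matching complex `M₇` of the complete graph `K₇`:
a nonempty matching of `K₇`, i.e. a nonempty finite set of pairwise
vertex-disjoint 2-element subsets ("edges") of `Fin 7`.
A `k`-simplex is a matching of size `k + 1`. -/
def IsSimplex (σ : Finset (Finset (Fin 7))) : Prop :=
  σ.Nonempty ∧ (∀ e ∈ σ, e.card = 2) ∧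
    ∀ e ∈ σ, ∀ f ∈ σ, e ≠ f → Disjoint e f

/-- A discrete vector field on `M₇`: a set `V` of pairs `(σ, τ)` of simplices
with `σ ⊂ τ` and `dim τ = dim σ + 1`, such that each simplex of `M₇`
belongs to at most one pair of `V`. -/
def IsDVF (V : Set (Finset (Finset (Fin 7)) × Finset (Finset (Fin 7)))) : Prop :=
  (∀ p ∈ V, IsSimplex p.1 ∧ IsSimplex p.2 ∧ p.1 ⊂ p.2 ∧ p.2.card = p.1.card + 1) ∧
  (∀ p ∈ V, ∀ q ∈ V, p ≠ q →
    p.1 ≠ q.1 ∧ p.1 ≠ q.2 ∧ p.2 ≠ q.1 ∧ p.2 ≠ q.2)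

/-- `V` admits a nontrivial closed `V`-path
`σ₀, τ₀, σ₁, τ₁, …, σₙ = σ₀` with `n ≥ 1`. -/
def HasClosedPath (V : Set (Finset (Finset (Fin 7)) × Finset (Finset (Fin 7)))) : Prop :=
  ∃ (n : ℕ) (σ τ : ℕ → Finset (Finset (Fin 7))),
    0 < n ∧ σ n = σ 0 ∧
    ∀ i < n, (σ i, τ i) ∈ V ∧ σ (i + 1) ⊂ τ i ∧ σ (i + 1) ≠ σ i ∧
      (σ (i + 1)).card = (σ i).card

/-- A gradient vector field on `M₇`: a discrete vector field admitting no
nontrivial closed `V`-path (an acyclic matching on the face poset). -/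
def IsGVF (V : Set (Finset (Finset (Fin 7)) × Finset (Finset (Fin 7)))) : Prop :=
  IsDVF V ∧ ¬ HasClosedPath V

/-- A simplex of `M₇` is critical with respect to `V` if it belongs to no pair of `V`. -/
def IsCritical (V : Set (Finset (Finset (Fin 7)) × Finset (Finset (Fin 7))))
    (σ : Finset (Finset (Fin 7))) : Prop :=
  IsSimplex σ ∧ ∀ p ∈ V, p.1 ≠ σ ∧ p.2 ≠ σ

/-- The number of critical `k`-simplices of `V` (matchings of size `k + 1`). -/
noncomputable def critCount (V : Set (Finset (Finset (Fin 7)) × Finset (Finset (Fin 7))))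
    (k : ℕ) : ℕ :=
  Set.ncard {σ | IsCritical V σ ∧ σ.card = k + 1}

/-- The total number of critical simplices of `V`. -/
noncomputable def totalCrit (V : Set (Finset (Finset (Fin 7)) × Finset (Finset (Fin 7)))) : ℕ :=
  Set.ncard {σ | IsCritical V σ}

open Finset

/-- A set of pairs of simplices of the matching complex. -/
abbrev PairSet := Set (Finset (Finset (Fin 7)) × Finset (Finset (Fin 7)))

/-! ### Enumerating the edges of `K₇` -/

/-- The edges of `K₇` in lexicographic order. -/
def edge : Fin 21 → Finset (Fin 7) :=
  ![{0, 1}, {0, 2}, {0, 3}, {0, 4}, {0, 5}, {0, 6}, {1, 2}, {1, 3}, {1, 4}, {1, 5}, {1, 6},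
    {2, 3}, {2, 4}, {2, 5}, {2, 6}, {3, 4}, {3, 5}, {3, 6}, {4, 5}, {4, 6}, {5, 6}]

theorem edge_injective : Function.Injective edge := by
  unfold Function.Injective
  decide +kernel

theorem card_edge (i : Fin 21) : (edge i).card = 2 := by
  revert i
  decide +kernel

theorem exists_edge_eq (e : Finset (Fin 7)) (he : e.card = 2) : ∃ i, edge i = e := by
  revert e
  decide +kernel

theorem edge_ne_of_disjoint {i j : Fin 21} (h : Disjoint (edge i) (edge j)) :
    edge i ≠ edge j := by
  intro hij
  have hc := card_edge j
  rw [hij, disjoint_self_iff_empty] at h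
  simp [h] at hc

theorem IsSimplex.mono {σ τ : Finset (Finset (Fin 7))} (hτ : IsSimplex τ) (h : σ ⊆ τ)
    (hσ : σ.Nonempty) : IsSimplex σ :=
  ⟨hσ, fun e he => hτ.2.1 e (h he), fun e he f hf => hτ.2.2 e (h he) f (h hf)⟩

theorem IsSimplex.card_le {σ : Finset (Finset (Fin 7))} (h : IsSimplex σ) : σ.card ≤ 3 := by
  have h1 : (σ.biUnion id).card = ∑ e ∈ σ, e.card := card_biUnion h.2.2
  rw [sum_congr rfl h.2.1, sum_const, smul_eq_mul] at h1
  have h2 : (σ.biUnion id).card ≤ 7 := card_le_univ _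
  omega

theorem isSimplex_pair {i j : Fin 21} (h : Disjoint (edge i) (edge j)) :
    IsSimplex {edge i, edge j} := by
  refine ⟨by simp, by simp [card_edge], ?_⟩
  simp [h, h.symm]

/-! ### Counting simplices -/

/-- The sets of indices of the `k`-element matchings of `K₇`. -/
def matchings (k : ℕ) : Finset (Finset (Fin 21)) :=
  (powersetCard k univ).filter fun s => ∀ i ∈ s, ∀ j ∈ s, i = j ∨ Disjoint (edge i) (edge j)

theorem ncard_isSimplex_eq {k : ℕ} (hk : k ≠ 0) :
    {σ | IsSimplex σ ∧ σ.card = k}.ncard = (matchings k).card := by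
  have hset : {σ | IsSimplex σ ∧ σ.card = k} =
      ((matchings k).map (mapEmbedding ⟨edge, edge_injective⟩).toEmbedding :
        Set (Finset (Finset (Fin 7)))) := by
    ext σ
    simp only [matchings, coe_map, coe_filter, mem_powersetCard, subset_univ, true_and,
      or_iff_not_imp_left, Set.mem_ofPred_eq, Set.mem_image, RelEmbedding.coe_toEmbedding,
      mapEmbedding_apply]
    constructor
    · rintro ⟨hσ, hc⟩
      have hmap : (univ.filter fun i => edge i ∈ σ).map ⟨edge, edge_injective⟩ = σ := by
        ext e
        simp only [mem_map, mem_filter, mem_univ, true_and, Function.Embedding.coeFn_mk]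
        constructor
        · rintro ⟨i, hi, rfl⟩
          exact hi
        · intro he
          obtain ⟨i, rfl⟩ := exists_edge_eq e (hσ.2.1 e he)
          exact ⟨i, he, rfl⟩
      refine ⟨_, ⟨?_, fun i hi j hj hij => ?_⟩, hmap⟩
      · rw [← hc, ← hmap, card_map, hmap]
      · simp only [mem_filter, mem_univ, true_and] at hi hj
        exact hσ.2.2 _ hi _ hj (edge_injective.ne hij)
    · rintro ⟨s, ⟨hc, hs⟩, rfl⟩
      refine ⟨⟨card_pos.1 (by rw [card_map]; omega), ?_, ?_⟩, by rw [card_map, hc]⟩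
      · simp [card_edge]
      · simp only [mem_map, Function.Embedding.coeFn_mk]
        rintro _ ⟨i, hi, rfl⟩ _ ⟨j, hj, rfl⟩ hij
        exact hs i hi j hj fun h => hij (by rw [h])
  rw [hset, Set.ncard_coe_finset, card_map]

theorem ncard_isSimplex_one : {σ | IsSimplex σ ∧ σ.card = 1}.ncard = 21 := by
  rw [ncard_isSimplex_eq one_ne_zero]
  decide +kernel

theorem ncard_isSimplex_two : {σ | IsSimplex σ ∧ σ.card = 2}.ncard = 105 := by
  rw [ncard_isSimplex_eq two_ne_zero]
  decide +kernel

theorem ncard_isSimplex_three : {σ | IsSimplex σ ∧ σ.card = 3}.ncard = 105 := by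
  rw [ncard_isSimplex_eq three_ne_zero]
  decide +kernel

/-! ### Counting critical simplices -/

theorem ncard_critical_add {V : PairSet} (hV : IsDVF V) (k : ℕ) :
    {σ | IsCritical V σ ∧ σ.card = k}.ncard + {p ∈ V | p.1.card = k}.ncard +
      {p ∈ V | p.2.card = k}.ncard = {σ | IsSimplex σ ∧ σ.card = k}.ncard := by
  have h1 : (Prod.fst '' {p ∈ V | p.1.card = k}).ncard = {p ∈ V | p.1.card = k}.ncard :=
    Set.InjOn.ncard_image fun p hp q hq h => by
      by_contra hne
      exact (hV.2 p hp.1 q hq.1 hne).1 h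
  have h2 : (Prod.snd '' {p ∈ V | p.2.card = k}).ncard = {p ∈ V | p.2.card = k}.ncard :=
    Set.InjOn.ncard_image fun p hp q hq h => by
      by_contra hne
      exact (hV.2 p hp.1 q hq.1 hne).2.2.2 h
  rw [← h1, ← h2, ← Set.ncard_union_eq, ← Set.ncard_union_eq]
  · congr 1
    ext σ
    constructor
    · rintro ((⟨h, hk⟩ | ⟨p, ⟨hp, hk⟩, rfl⟩) | ⟨p, ⟨hp, hk⟩, rfl⟩)
      · exact ⟨h.1, hk⟩
      · exact ⟨(hV.1 p hp).1, hk⟩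
      · exact ⟨(hV.1 p hp).2.1, hk⟩
    · rintro ⟨h, hk⟩
      by_cases hc : IsCritical V σ
      · exact Or.inl (Or.inl ⟨hc, hk⟩)
      · simp only [IsCritical, h, true_and, not_forall, not_and_or, not_not] at hc
        obtain ⟨p, hp, rfl | rfl⟩ := hc
        · exact Or.inl (Or.inr ⟨p, ⟨hp, hk⟩, rfl⟩)
        · exact Or.inr ⟨p, ⟨hp, hk⟩, rfl⟩
  · rw [Set.disjoint_left]
    rintro σ (⟨h, -⟩ | ⟨p, ⟨hp, -⟩, rfl⟩) ⟨q, ⟨hq, -⟩, hqσ⟩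
    · exact (h.2 q hq).2 hqσ
    · by_cases hpq : p = q
      · subst hpq
        exact (hV.1 p hp).2.2.1.ne hqσ.symm
      · exact (hV.2 p hp q hq hpq).2.1 hqσ.symm
  · rw [Set.disjoint_left]
    rintro σ ⟨h, -⟩ ⟨q, ⟨hq, -⟩, hqσ⟩
    exact (h.2 q hq).1 hqσ

theorem totalCrit_eq_add (V : PairSet) :
    totalCrit V = critCount V 0 + critCount V 1 + critCount V 2 := by
  unfold totalCrit critCount
  rw [← Set.ncard_union_eq, ← Set.ncard_union_eq]
  · congr 1
    ext σ
    simp only [Set.mem_ofPred_eq, Set.mem_union, ← and_or_left]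
    refine ⟨fun h => ⟨h, ?_⟩, And.left⟩
    have h1 := h.1.1.card_pos
    have h2 := h.1.card_le
    omega
  all_goals
    rw [Set.disjoint_left]
    simp only [Set.mem_ofPred_eq, Set.mem_union]
    omega

theorem critCount_eqs {V : PairSet} (hV : IsDVF V) :
    critCount V 0 + {p ∈ V | p.1.card = 1}.ncard = 21 ∧
    critCount V 1 + {p ∈ V | p.1.card = 2}.ncard + {p ∈ V | p.1.card = 1}.ncard = 105 ∧
    critCount V 2 + {p ∈ V | p.1.card = 2}.ncard = 105 := by
  have e1 : {p ∈ V | p.2.card = 1} = ∅ := by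
    ext p
    simp only [Set.mem_ofPred_eq, Set.mem_empty_iff_false, iff_false, not_and]
    intro hp
    have h1 := (hV.1 p hp).1.1.card_pos
    have h2 := (hV.1 p hp).2.2.2
    omega
  have e2 : {p ∈ V | p.2.card = 2} = {p ∈ V | p.1.card = 1} := by
    ext p
    refine and_congr_right fun hp => ?_
    have h2 := (hV.1 p hp).2.2.2
    omega
  have e3 : {p ∈ V | p.2.card = 3} = {p ∈ V | p.1.card = 2} := by
    ext p
    refine and_congr_right fun hp => ?_
    have h2 := (hV.1 p hp).2.2.2
    omega
  have e4 : {p ∈ V | p.1.card = 3} = ∅ := by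
    ext p
    simp only [Set.mem_ofPred_eq, Set.mem_empty_iff_false, iff_false, not_and]
    intro hp
    have h1 := (hV.1 p hp).2.1.card_le
    have h2 := (hV.1 p hp).2.2.2
    omega
  have c1 := ncard_critical_add hV 1
  have c2 := ncard_critical_add hV 2
  have c3 := ncard_critical_add hV 3
  rw [e1, Set.ncard_empty, ncard_isSimplex_one] at c1
  rw [e2, ncard_isSimplex_two] at c2
  rw [e3, e4, Set.ncard_empty, ncard_isSimplex_three] at c3
  exact ⟨c1, c2, c3⟩

/-! ### A 3-torsion obstruction to having no critical edge -/

/-- The oriented 1-simplices on which `cocycle` takes the value `1`. -/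
def cocycleSupport : List (Fin 21 × Fin 21) :=
  [(2, 6), (2, 18), (2, 19), (4, 7), (4, 10), (4, 12), (5, 8), (5, 11), (5, 13), (7, 3),
    (7, 13), (7, 14), (9, 2), (9, 5), (9, 12), (10, 1), (10, 15), (10, 18), (11, 3), (11, 9),
    (11, 10), (13, 0), (13, 15), (13, 19), (14, 2), (14, 4), (14, 8), (15, 4), (15, 5), (15, 6),
    (16, 1), (16, 8), (17, 0), (17, 12), (18, 0), (18, 11), (18, 14), (19, 1), (19, 7), (19, 9),
    (20, 3), (20, 6)]

/-- A 1-cocycle of `M₇` with values in `ZMod 3` which is not a coboundary. -/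
def cocycle (i j : Fin 21) : ZMod 3 :=
  if (i, j) ∈ cocycleSupport then 1 else if (j, i) ∈ cocycleSupport then -1 else 0

theorem cocycle_swap (i j : Fin 21) : cocycle j i = -cocycle i j := by
  revert i j
  decide +kernel

theorem cocycle_add (i j k : Fin 21) (hij : Disjoint (edge i) (edge j))
    (hik : Disjoint (edge i) (edge k)) (hjk : Disjoint (edge j) (edge k)) :
    cocycle i j + cocycle j k = cocycle i k := by
  have key : ∀ i j, Disjoint (edge i) (edge j) → ∀ k, Disjoint (edge i) (edge k) →
      Disjoint (edge j) (edge k) → cocycle i j + cocycle j k = cocycle i k := by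
    decide +kernel
  exact key i j hij k hik hjk

theorem cocycle_not_coboundary (f : Fin 21 → ZMod 3) :
    ∃ i j, Disjoint (edge i) (edge j) ∧ cocycle i j ≠ f j - f i := by
  by_contra! h
  have h1 := h 0 11 (by decide)
  have h2 := h 11 3 (by decide)
  have h3 := h 3 13 (by decide)
  have h4 := h 13 0 (by decide)
  have h5 : cocycle 0 11 + cocycle 11 3 + cocycle 3 13 + cocycle 13 0 ≠ 0 := by decide +kernel
  apply h5
  rw [h1, h2, h3, h4]
  ring

/-- One step of a `V`-path, from `σ` to `σ'`. -/
def PathStep (V : PairSet) (σ' σ : Finset (Finset (Fin 7))) : Prop :=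
  ∃ τ, (σ, τ) ∈ V ∧ σ' ⊂ τ ∧ σ' ≠ σ ∧ σ'.card = σ.card

theorem exists_path_of_transGen {V : PairSet} {σ σ' : Finset (Finset (Fin 7))}
    (h : Relation.TransGen (fun a b => PathStep V b a) σ σ') :
    ∃ (n : ℕ) (s t : ℕ → Finset (Finset (Fin 7))), 0 < n ∧ s 0 = σ ∧ s n = σ' ∧
      ∀ i < n, (s i, t i) ∈ V ∧ s (i + 1) ⊂ t i ∧ s (i + 1) ≠ s i ∧
        (s (i + 1)).card = (s i).card := by
  induction h using Relation.TransGen.head_induction_on with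
  | @single a h =>
    obtain ⟨τ, h⟩ := h
    refine ⟨1, fun i => if i = 0 then a else σ', fun _ => τ, by simp, by simp, by simp, ?_⟩
    intro i hi
    obtain rfl : i = 0 := by omega
    simpa using h
  | @head a c h _ ih =>
    obtain ⟨τ, h⟩ := h
    obtain ⟨n, s, t, hn, hs0, hsn, hst⟩ := ih
    refine ⟨n + 1, fun i => i.casesOn a s, fun i => i.casesOn τ t, by simp, rfl, hsn, ?_⟩
    rintro (_ | i) hi
    · simpa [hs0] using h
    · exact hst i (by omega)

theorem wellFounded_pathStep {V : PairSet} (hV : ¬ HasClosedPath V) :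
    WellFounded (PathStep V) := by
  have irr : Std.Irrefl (Relation.TransGen (PathStep V)) := ⟨fun σ h => hV <| by
    obtain ⟨n, s, t, hn, h0, hsn, hst⟩ := exists_path_of_transGen (Relation.transGen_swap.1 h)
    exact ⟨n, s, t, hn, hsn.trans h0.symm, hst⟩⟩
  have wf : WellFounded (Relation.TransGen (PathStep V)) :=
    Finite.wellFounded_of_trans_of_irrefl _
  exact Subrelation.wf Relation.TransGen.single wf

theorem exists_potential {α G : Type*} [AddCommGroup G] {R : α → α → Prop}
    (wf : WellFounded fun j i => R i j) (hR : ∀ i j k, R i j → R i k → j = k)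
    (φ : α → α → G) : ∃ f : α → G, ∀ i j, R i j → φ i j = f j - f i := by
  classical
  refine ⟨wf.fix fun i F =>
    if h : ∃ j, R i j then F h.choose h.choose_spec - φ i h.choose else 0, fun i j hij => ?_⟩
  have h : ∃ j, R i j := ⟨j, hij⟩
  have hj := hR i j _ hij h.choose_spec
  rw [wf.fix_eq _ i, dif_pos h]
  dsimp only
  rw [← hj]
  abel

theorem exists_critical_card_two {V : PairSet} (hV : IsGVF V) :
    ∃ σ, IsCritical V σ ∧ σ.card = 2 := by
  by_contra! hcrit
  have wf := wellFounded_pathStep hV.2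
  let R : Fin 21 → Fin 21 → Prop := fun i j =>
    edge i ≠ edge j ∧ ({edge i}, {edge i, edge j}) ∈ V
  have wfR : WellFounded fun j i => R i j := by
    refine Subrelation.wf ?_ (InvImage.wf (fun i => {edge i}) wf)
    rintro j i ⟨hne, hij⟩
    refine ⟨_, hij, ?_, by simpa using hne.symm, by simp⟩
    rw [Finset.ssubset_iff_of_subset (by simp)]
    exact ⟨edge i, by simp, by simpa using hne⟩
  have hR : ∀ i j k, R i j → R i k → j = k := by
    rintro i j k ⟨hj, hij⟩ ⟨hk, hik⟩
    have heq : ({edge i, edge j} : Finset (Finset (Fin 7))) = {edge i, edge k} := by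
      by_contra hne
      exact (hV.1.2 _ hij _ hik (by simpa using hne)).1 rfl
    have hmem : edge j ∈ ({edge i, edge k} : Finset (Finset (Fin 7))) := by simp [← heq]
    rw [mem_insert, mem_singleton] at hmem
    exact edge_injective (hmem.resolve_left hj.symm)
  obtain ⟨f, hf⟩ := exists_potential wfR hR cocycle
  obtain ⟨i, j, hij, hne⟩ := cocycle_not_coboundary f
  refine hne ?_
  suffices H : ∀ σ : Finset (Finset (Fin 7)), ∀ i j, σ = {edge i, edge j} →
      Disjoint (edge i) (edge j) → cocycle i j = f j - f i from H _ i j rfl hij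
  intro σ
  induction σ using wf.induction with
  | _ σ ih =>
  rintro i j rfl hij
  have hne := edge_ne_of_disjoint hij
  have hcard : ({edge i, edge j} : Finset (Finset (Fin 7))).card = 2 := card_pair hne
  have hnc : ¬ IsCritical V {edge i, edge j} := fun h => hcrit _ h hcard
  simp only [IsCritical, isSimplex_pair hij, true_and, not_forall, not_and_or, not_not] at hnc
  obtain ⟨⟨σ, τ⟩, hp, h⟩ := hnc
  obtain ⟨hσ, hτ, hlt, hc⟩ := hV.1.1 _ hp
  dsimp only at hσ hτ hlt hc h
  rcases h with rfl | rfl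
  · obtain ⟨e, he, rfl⟩ := exists_eq_insert_iff.2 ⟨hlt.1, hc.symm⟩
    obtain ⟨k, rfl⟩ := exists_edge_eq e (hτ.2.1 e (by simp))
    simp only [mem_insert, mem_singleton, not_or] at he
    have hik : Disjoint (edge i) (edge k) := hτ.2.2 _ (by simp) _ (by simp) (Ne.symm he.1)
    have hjk : Disjoint (edge j) (edge k) := hτ.2.2 _ (by simp) _ (by simp) (Ne.symm he.2)
    have step : ∀ a b, Disjoint (edge a) (edge b) →
        ({edge a, edge b} : Finset (Finset (Fin 7))) ⊆ {edge k, edge i, edge j} →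
        edge k ∈ ({edge a, edge b} : Finset (Finset (Fin 7))) →
        PathStep V {edge a, edge b} {edge i, edge j} := by
      intro a b hab hsub hk
      have hcab := card_pair (edge_ne_of_disjoint hab)
      refine ⟨_, hp, hsub.ssubset_of_ne fun h => ?_, fun h => ?_, hcab.trans hcard.symm⟩
      · rw [← h] at hc
        omega
      · rw [h] at hk
        simp [he.1, he.2] at hk
    have h1 := ih _ (step i k hik (by simp [insert_subset_iff]) (by simp)) i k rfl hik
    have h2 := ih _ (step j k hjk (by simp [insert_subset_iff]) (by simp)) j k rfl hjk
    have h3 := cocycle_add i j k hij hik hjk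
    rw [h1, h2] at h3
    rw [eq_sub_of_add_eq h3]
    ring
  · obtain ⟨e, rfl⟩ := card_eq_one.1 (show σ.card = 1 by omega)
    have he := hlt.1 (mem_singleton_self e)
    rw [mem_insert, mem_singleton] at he
    rcases he with rfl | rfl
    · exact hf i j ⟨hne, hp⟩
    · rw [pair_comm] at hp
      rw [cocycle_swap j i, hf j i ⟨hne.symm, hp⟩]
      ring

theorem le_totalCrit {V : PairSet} (hV : IsGVF V) : 23 ≤ totalCrit V := by
  obtain ⟨σ, hσ⟩ := exists_critical_card_two hV
  have h1 : 0 < critCount V 1 := (Set.ncard_pos (Set.toFinite _)).2 ⟨σ, hσ⟩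
  have h2 := critCount_eqs hV.1
  have h3 := totalCrit_eq_add V
  omega

/-! ### An optimal gradient vector field -/

theorem isGVF_of_pairwise {L : List (Finset (Finset (Fin 7)) × Finset (Finset (Fin 7)))}
    (hL : ∀ p ∈ L, IsSimplex p.1 ∧ IsSimplex p.2 ∧ p.1 ⊂ p.2 ∧ p.2.card = p.1.card + 1)
    (hp : L.Pairwise fun p q => ¬ p.1 ⊆ q.2) : IsGVF {p | p ∈ L} := by
  have key : ∀ i j : Fin L.length, (L.get i).1 ⊆ (L.get j).2 → j ≤ i := fun i j h =>
    not_lt.1 fun hij => List.pairwise_iff_get.1 hp i j hij h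
  have sub : ∀ i : Fin L.length, (L.get i).1 ⊆ (L.get i).2 := fun i =>
    (hL _ (L.get_mem i)).2.2.1.1
  have inj : ∀ i j : Fin L.length, (L.get i).1 = (L.get j).1 → i = j := fun i j h =>
    le_antisymm (key j i (h ▸ sub i)) (key i j (h ▸ sub j))
  refine ⟨⟨hL, ?_⟩, ?_⟩
  · have cross : ∀ p ∈ L, ∀ q ∈ L, p ≠ q → p.1 ≠ q.2 := by
      intro p hp q hq hne h
      obtain ⟨i, rfl⟩ := List.get_of_mem hp
      obtain ⟨j, rfl⟩ := List.get_of_mem hq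
      have h1 := key i j h.subset
      have h2 := key j i ((sub j).trans (h ▸ sub i))
      exact hne (by rw [le_antisymm h1 h2])
    intro p hp q hq hne
    refine ⟨fun h => ?_, cross p hp q hq hne, fun h => cross q hq p hp hne.symm h.symm,
      fun h => ?_⟩
    · obtain ⟨i, rfl⟩ := List.get_of_mem hp
      obtain ⟨j, rfl⟩ := List.get_of_mem hq
      exact hne (by rw [inj i j h])
    · obtain ⟨i, rfl⟩ := List.get_of_mem hp
      obtain ⟨j, rfl⟩ := List.get_of_mem hq
      exact hne (by rw [le_antisymm (key j i (h ▸ sub j)) (key i j (h ▸ sub i))])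
  · rintro ⟨n, σ, τ, hn, hclosed, hpath⟩
    have idx : ∀ i < n, ∃ k, L.get k = (σ i, τ i) := fun i hi =>
      List.get_of_mem (hpath i hi).1
    obtain ⟨k₀, hk₀⟩ := idx 0 hn
    have mono : ∀ i < n, ∃ k, L.get k = (σ i, τ i) ∧ k₀ ≤ k := by
      intro i
      induction i with
      | zero => exact fun _ => ⟨k₀, hk₀, le_rfl⟩
      | succ i ih =>
        intro hi
        obtain ⟨k, hk, hle⟩ := ih (by omega)
        obtain ⟨k', hk'⟩ := idx (i + 1) hi
        refine ⟨k', hk', hle.trans (key k' k ?_)⟩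
        rw [hk, hk']
        exact (hpath i (by omega)).2.1.1
    obtain ⟨k, hk, hle⟩ := mono (n - 1) (by omega)
    obtain ⟨-, hlt, hne, -⟩ := hpath (n - 1) (by omega)
    rw [Nat.sub_add_cancel hn, hclosed] at hlt hne
    have hge : k ≤ k₀ := key k₀ k (by rw [hk, hk₀]; exact hlt.1)
    rw [le_antisymm hge hle, hk₀] at hk
    exact hne (congrArg Prod.fst hk)

/-- The set of edges of `K₇` with indices in a given list. -/
def cell (l : List (Fin 21)) : Finset (Finset (Fin 7)) :=
  l.toFinset.map ⟨edge, edge_injective⟩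

theorem cell_subset_cell {l m : List (Fin 21)} : cell l ⊆ cell m ↔ l ⊆ m := by
  rw [cell, cell, map_subset_map]
  simp [subset_iff, List.subset_def]

theorem card_cell {l : List (Fin 21)} (h : l.Nodup) : (cell l).card = l.length := by
  simp [cell, List.toFinset_card_of_nodup h]

theorem isSimplex_cell {l : List (Fin 21)} (h0 : l ≠ [])
    (h : l.Pairwise fun i j => Disjoint (edge i) (edge j)) : IsSimplex (cell l) := by
  refine ⟨by simpa [cell] using h0, by simp [cell, card_edge], ?_⟩
  simp only [cell, mem_map, List.mem_toFinset, Function.Embedding.coeFn_mk]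
  rintro _ ⟨i, hi, rfl⟩ _ ⟨j, hj, rfl⟩ hij
  have : Std.Symm fun i j => Disjoint (edge i) (edge j) := ⟨fun _ _ h => h.symm⟩
  exact h.forall hi hj fun h => hij (by rw [h])

/-- An optimal collapsing order: the list `[c, a, b]` stands for the pair
`({a, b}, {c, a, b})`, and `[c, a]` for `({a}, {c, a})`. -/
def optimalList : List (List (Fin 21)) :=
  [[11, 5, 8], [18, 5, 11], [7, 5, 18], [6, 5, 16], [15, 5, 6], [3, 6, 16], [10, 1, 15],
    [7, 5, 13], [9, 5, 15], [12, 5, 7], [12, 5, 9], [14, 9, 15], [20, 3, 6], [7, 3, 20],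
    [13, 10, 15], [0, 13, 15], [11, 4, 10], [17, 1, 9], [2, 10, 13], [16, 0, 12], [10, 12, 16],
    [2, 10, 12], [18, 2, 10], [7, 1, 19], [13, 7, 19], [0, 16, 19], [14, 0, 16], [3, 7, 13],
    [17, 3, 13], [9, 3, 17], [12, 9, 17], [14, 3, 7], [4, 12, 17], [2, 9, 12], [20, 2, 12],
    [6, 2, 20], [7, 4, 12], [20, 7, 12], [15, 6, 20], [4, 6, 15], [1, 7, 20], [8, 1, 20],
    [0, 15, 20], [14, 4, 7], [18, 7, 14], [11, 0, 20], [1, 7, 18], [11, 8, 20], [4, 8, 11],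
    [14, 0, 15], [14, 4, 15], [19, 4, 11], [6, 4, 19], [8, 4, 14], [18, 0, 14], [2, 6, 19],
    [17, 4, 8], [17, 4, 6], [18, 2, 6], [17, 6, 18], [2, 14, 18], [11, 10, 18], [17, 1, 18],
    [3, 10, 11], [16, 1, 10], [16, 3, 10], [0, 11, 18], [8, 1, 16], [19, 0, 11], [8, 1, 17],
    [14, 3, 16], [8, 14, 16], [13, 8, 17], [17, 0, 18], [13, 0, 17], [9, 3, 11], [2, 8, 14],
    [9, 2, 14], [19, 0, 13], [3, 9, 14], [2, 13, 19], [19, 2, 9], [13, 2, 8], [19, 9, 11],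
    [16, 10], [1, 7], [12, 5], [14, 15], [17, 6], [17, 4], [8, 16], [8, 1], [20, 12], [3, 14],
    [13, 17], [13, 8], [11, 20], [9, 3], [2, 18], [2, 13], [19, 11], [19, 9], [19, 2], [0, 19]]

/-- The pair of cells encoded by a member of `optimalList`. -/
def cellPair (l : List (Fin 21)) : Finset (Finset (Fin 7)) × Finset (Finset (Fin 7)) :=
  (cell l.tail, cell l)

/-- An optimal gradient vector field. -/
def optimalField : PairSet := {p | p ∈ optimalList.map cellPair}

theorem optimalList_disjoint :
    ∀ l ∈ optimalList, l.Pairwise fun i j => Disjoint (edge i) (edge j) := by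
  decide +kernel

theorem optimalList_nodup : ∀ l ∈ optimalList, l.Nodup := by
  decide +kernel

theorem tail_ne_nil_of_mem_optimalList : ∀ l ∈ optimalList, l.tail ≠ [] := by
  decide +kernel

theorem optimalList_pairwise : optimalList.Pairwise fun l m => ¬ l.tail ⊆ m := by
  decide +kernel

theorem isGVF_optimalField : IsGVF optimalField := by
  refine isGVF_of_pairwise ?_ ?_
  · simp only [List.mem_map, forall_exists_index, and_imp, forall_apply_eq_imp_iff₂]
    intro l hl
    have ht := tail_ne_nil_of_mem_optimalList l hl
    have hd := optimalList_disjoint l hl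
    have hn := optimalList_nodup l hl
    have hl0 : l ≠ [] := by rintro rfl; exact ht rfl
    have hc : (cell l).card = (cell l.tail).card + 1 := by
      rw [card_cell hn, card_cell hn.tail, List.length_tail]
      have := List.length_pos_iff.2 hl0
      omega
    refine ⟨isSimplex_cell ht hd.tail, isSimplex_cell hl0 hd, ?_, hc⟩
    refine (cell_subset_cell.2 (List.tail_subset l)).ssubset_of_ne fun h => ?_
    rw [h] at hc
    omega
  · rw [List.pairwise_map]
    exact optimalList_pairwise.imp fun h h' => h (cell_subset_cell.1 h')

theorem ncard_optimalField (k : ℕ) :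
    {p ∈ optimalField | p.1.card = k}.ncard =
      (optimalList.filter fun l => l.tail.length = k).length := by
  have hset : {p ∈ optimalField | p.1.card = k} =
      (((optimalList.filter fun l => l.tail.length = k).map cellPair).toFinset :
        Set (Finset (Finset (Fin 7)) × Finset (Finset (Fin 7)))) := by
    ext p
    simp only [optimalField, Set.mem_ofPred_eq, List.mem_map, List.coe_toFinset, List.mem_filter,
      decide_eq_true_eq]
    constructor
    · rintro ⟨⟨l, hl, rfl⟩, hk⟩
      exact ⟨l, ⟨hl, by rwa [cellPair, card_cell (optimalList_nodup l hl).tail] at hk⟩, rfl⟩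
    · rintro ⟨l, ⟨hl, hk⟩, rfl⟩
      exact ⟨⟨l, hl, rfl⟩, by rwa [cellPair, card_cell (optimalList_nodup l hl).tail]⟩
  have hnd : ((optimalList.filter fun l => l.tail.length = k).map cellPair).Nodup := by
    rw [List.Nodup, List.pairwise_map]
    refine (optimalList_pairwise.filter _).imp fun {l m} h heq => h ?_
    rw [← cell_subset_cell, show cell m = cell l from (congrArg Prod.snd heq).symm,
      cell_subset_cell]
    exact List.tail_subset l
  rw [hset, Set.ncard_coe_finset, List.toFinset_card_of_nodup hnd, List.length_map]

theorem critCount_optimalField :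
    critCount optimalField 0 = 1 ∧ critCount optimalField 1 = 1 ∧
      critCount optimalField 2 = 21 := by
  have h := critCount_eqs isGVF_optimalField.1
  rw [ncard_optimalField 1, ncard_optimalField 2,
    show (optimalList.filter fun l => l.tail.length = 1).length = 20 by decide +kernel,
    show (optimalList.filter fun l => l.tail.length = 2).length = 84 by decide +kernel] at h
  omega

theorem totalCrit_optimalField : totalCrit optimalField = 23 := by
  rw [totalCrit_eq_add]
  have := critCount_optimalField
  omega

/-- The minimum over all gradient vector fields on `M₇` of the total number of
critical simplices is exactly 23, attained with 21 critical 2-simplices,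
1 critical 1-simplex, and 1 critical 0-simplex. -/
theorem min_total_critical_on_M7 :
    IsLeast {n : ℕ | ∃ V : Set (Finset (Finset (Fin 7)) × Finset (Finset (Fin 7))),
        IsGVF V ∧ totalCrit V = n} 23 ∧
    ∃ V : Set (Finset (Finset (Fin 7)) × Finset (Finset (Fin 7))),
      IsGVF V ∧ totalCrit V = 23 ∧
        critCount V 2 = 21 ∧ critCount V 1 = 1 ∧ critCount V 0 = 1 := by
  obtain ⟨h0, h1, h2⟩ := critCount_optimalField
  refine ⟨⟨⟨optimalField, isGVF_optimalField, totalCrit_optimalField⟩, ?_⟩,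
    optimalField, isGVF_optimalField, totalCrit_optimalField, h2, h1, h0⟩
  rintro n ⟨V, hV, rfl⟩
  exact le_totalCrit hV
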